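/- arXiv:1403.0104 — 7 statements merged into one kernel-verified Lean document; each statement's English description precedes it below -/
import Mathlib

section
/- Let v' = (r',ξ',a') and v'' = (r'',ξ'',a'') be elements of M(Λ) with r' ≠ 0, r'' ≠ 0 and r := r' + r'' ≠ 0, and set v := v' + v'' = (r,ξ,a) and D := r·ξ' − r'·ξ ∈ Λ. Then Δ(v) − (r'/r)·Δ(v') − (r''/r)·Δ(v'') = −(D,D)/(2·r'·r''·r²). -/
/-- The Mukai pairing on the rational Mukai lattice `M(Λ) = ℚ × Λ × ℚ`:
`⟨(r,ξ,a),(r',ξ',a')⟩ = (ξ,ξ') − r·a' − r'·a`. -/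
def mukaiPair {Λ : Type*} [AddCommGroup Λ] [Module ℚ Λ]
    (B : Λ →ₗ[ℚ] Λ →ₗ[ℚ] ℚ) (x y : ℚ × Λ × ℚ) : ℚ :=
  B x.2.1 y.2.1 - x.1 * y.2.2 - y.1 * x.2.2

/-- The discriminant `Δ(v) = ⟨v,v⟩/(2r²) + 1` of a Mukai vector `v = (r,ξ,a)`. -/
def mukaiDisc {Λ : Type*} [AddCommGroup Λ] [Module ℚ Λ]
    (B : Λ →ₗ[ℚ] Λ →ₗ[ℚ] ℚ) (v : ℚ × Λ × ℚ) : ℚ :=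
  mukaiPair B v v / (2 * v.1 ^ 2) + 1

/-- For `v' = (r',ξ',a')`, `v'' = (r'',ξ'',a'')` with `r', r'', r = r'+r''` nonzero,
`v = v' + v''` and `D = r·ξ' − r'·ξ`, one has
`Δ(v) − (r'/r)·Δ(v') − (r''/r)·Δ(v'') = −(D,D)/(2·r'·r''·r²)`. -/
theorem mukai_discriminant_decomposition
    {Λ : Type*} [AddCommGroup Λ] [Module ℚ Λ]
    (B : Λ →ₗ[ℚ] Λ →ₗ[ℚ] ℚ) (hB : ∀ x y, B x y = B y x)
    (r' r'' a' a'' : ℚ) (ξ' ξ'' : Λ)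
    (hr' : r' ≠ 0) (hr'' : r'' ≠ 0) (hr : r' + r'' ≠ 0)
    (v' v'' v : ℚ × Λ × ℚ) (D : Λ)
    (hv' : v' = (r', ξ', a')) (hv'' : v'' = (r'', ξ'', a''))
    (hv : v = v' + v'')
    (hD : D = (r' + r'') • ξ' - r' • (ξ' + ξ'')) :
    mukaiDisc B v - (r' / (r' + r'')) * mukaiDisc B v'
      - (r'' / (r' + r'')) * mukaiDisc B v''
      = - B D D / (2 * r' * r'' * (r' + r'') ^ 2) := by
  subst hv' hv'' hv hD
  have h := hB ξ'' ξ'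
  simp only [mukaiDisc, mukaiPair, Prod.mk_add_mk, map_add, map_sub, map_smul,
    LinearMap.add_apply, LinearMap.sub_apply, LinearMap.smul_apply, smul_eq_mul, h]
  field_simp
  ring
end

section
/- Let v' = (r',ξ',a') and v'' = (r'',ξ'',a'') be elements of M(Λ) with r' > 0 and r'' > 0, set r := r' + r'', v := v' + v'' = (r,ξ,a), and D := r·ξ' − r'·ξ ∈ Λ. Assume the Bogomolov inequalities Δ(v') ≥ 0 and Δ(v'') ≥ 0, and assume (D,D) ≤ 0. Then −(r⁴/2)·Δ(v) ≤ (D,D) ≤ 0, and in particular Δ(v) ≥ 0. (This is the lattice-theoretic content of Lemma 2.6: if a μ_ω-semistable sheaf F of topological type τ has a subsheaf E of the same slope, then D = r·c₁(E) − rk(E)·c₁(F) satisfies −(r⁴/2)Δ(τ) ≤ D² ≤ 0.) -/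
/-- Lattice-theoretic content of Lemma 2.6: if `r', r'' > 0`, `Δ(v') ≥ 0`, `Δ(v'') ≥ 0`
and `(D,D) ≤ 0` for `D = r·ξ' − r'·ξ`, `v = v' + v''`, `r = r' + r''`, then
`−(r⁴/2)·Δ(v) ≤ (D,D) ≤ 0` and in particular `Δ(v) ≥ 0`. -/
theorem mukai_wall_bound
    {Λ : Type*} [AddCommGroup Λ] [Module ℚ Λ]
    (B : Λ →ₗ[ℚ] Λ →ₗ[ℚ] ℚ) (hB : ∀ x y, B x y = B y x)
    (r' r'' a' a'' : ℚ) (ξ' ξ'' : Λ)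
    (hr' : 0 < r') (hr'' : 0 < r'')
    (v' v'' v : ℚ × Λ × ℚ) (D : Λ)
    (hv' : v' = (r', ξ', a')) (hv'' : v'' = (r'', ξ'', a''))
    (hv : v = v' + v'')
    (hD : D = (r' + r'') • ξ' - r' • (ξ' + ξ''))
    (hΔ' : 0 ≤ mukaiDisc B v') (hΔ'' : 0 ≤ mukaiDisc B v'')
    (hDD : B D D ≤ 0) :
    -((r' + r'') ^ 4 / 2) * mukaiDisc B v ≤ B D D
      ∧ B D D ≤ 0 ∧ 0 ≤ mukaiDisc B v := by
  have hr : 0 < r' + r'' := by positivity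
  have key : mukaiDisc B v * (2 * (r' + r'') ^ 2 * r' * r'') =
      2 * (r' + r'') * r' * r'' * (r' * mukaiDisc B v' + r'' * mukaiDisc B v'') - B D D := by
    subst hv hv' hv'' hD
    simp only [mukaiDisc, mukaiPair, Prod.mk_add_mk, map_add, map_sub, map_smul,
      LinearMap.add_apply, LinearMap.sub_apply, LinearMap.smul_apply, smul_eq_mul, hB ξ'' ξ']
    field_simp
    ring
  generalize mukaiDisc B v = d at *
  generalize mukaiDisc B v' = d' at *
  generalize mukaiDisc B v'' = d'' at *
  generalize B D D = q at *
  have h1 : 0 ≤ 2 * (r' + r'') * r' * r'' * (r' * d' + r'' * d'') := by positivity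
  have hpos : 0 < 2 * (r' + r'') ^ 2 * r' * r'' := by positivity
  have hd : 0 ≤ d := by
    by_contra hneg
    push Not at hneg
    have := mul_neg_of_neg_of_pos hneg hpos
    linarith
  refine ⟨?_, hDD, hd⟩
  have h2 : 0 ≤ d * ((r' + r'') ^ 2 * (r' - r'') ^ 2) := by positivity
  nlinarith [h1, h2, key]
end

section
/- Let v' = (r',ξ',a') and v'' = (r'',ξ'',a'') be elements of M(Λ) with r' > 0 and r'' > 0, set r := r' + r'', v := v' + v'' = (r,ξ,a), and D := r·ξ' − r'·ξ ∈ Λ. Assume Δ(v) ≥ 0, Δ(v') ≥ 0 and Δ(v'') ≥ 0. Then (D,D) ≥ −(r⁴/2)·Δ(v). (This is Step 1 in the proof of Proposition 4.12 on twisted walls: for a properly μ_{α,ω}-semistable twisted sheaf, the destabilizing class D lies in W_{α,v} ∪ {0}.) -/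
/-- Step 1 in the proof of Proposition 4.12 (twisted walls): if `r', r'' > 0`,
`Δ(v) ≥ 0`, `Δ(v') ≥ 0` and `Δ(v'') ≥ 0`, where `v = v' + v''` and
`D = r·ξ' − r'·ξ` with `r = r' + r''`, then `(D,D) ≥ −(r⁴/2)·Δ(v)`. -/
theorem mukai_twisted_wall_bound
    {Λ : Type*} [AddCommGroup Λ] [Module ℚ Λ]
    (B : Λ →ₗ[ℚ] Λ →ₗ[ℚ] ℚ) (hB : ∀ x y, B x y = B y x)
    (r' r'' a' a'' : ℚ) (ξ' ξ'' : Λ)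
    (hr' : 0 < r') (hr'' : 0 < r'')
    (v' v'' v : ℚ × Λ × ℚ) (D : Λ)
    (hv' : v' = (r', ξ', a')) (hv'' : v'' = (r'', ξ'', a''))
    (hv : v = v' + v'')
    (hD : D = (r' + r'') • ξ' - r' • (ξ' + ξ''))
    (hΔ : 0 ≤ mukaiDisc B v)
    (hΔ' : 0 ≤ mukaiDisc B v') (hΔ'' : 0 ≤ mukaiDisc B v'') :
    -((r' + r'') ^ 4 / 2) * mukaiDisc B v ≤ B D D := by
  have key : B D D = 2 * (r' + r'') * r' * r'' * (r' * mukaiDisc B v' + r'' * mukaiDisc B v''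
      - (r' + r'') * mukaiDisc B v) := by
    have h : r' + r'' ≠ 0 := by positivity
    subst hv hv' hv'' hD
    simp only [mukaiDisc, mukaiPair, Prod.mk_add_mk, map_add, map_sub, map_smul,
      LinearMap.add_apply, LinearMap.sub_apply, LinearMap.smul_apply, smul_eq_mul, hB ξ'' ξ']
    field_simp
    ring
  rw [key]
  have h1 : 0 ≤ 2 * (r' + r'') * r' * r'' * (r' * mukaiDisc B v' + r'' * mukaiDisc B v'') := by
    positivity
  have h2 : 0 ≤ (r' + r'') ^ 2 / 2 * (r' - r'') ^ 2 * mukaiDisc B v := by positivity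
  linear_combination h1 + h2
end

section
/- Let u = (r,ξ,c) ∈ M(Λ) with r ≠ 0, and set s := (r, 0, c − (ξ,ξ)/(2r)). Then: (i) s·s = u·u^∨ (so s is a square root of u·u^∨); (ii) s is invertible in M(Λ); (iii) the map h : M(Λ) → M(Λ), h(β) := β·u^∨·s^{−1}, preserves the Mukai pairing; (iv) h(u·(1,0,1)) = (r, 0, r + c − (ξ,ξ)/(2r)). In particular, setting v := u·(1,0,1) and w := (r, 0, r + c − (ξ,ξ)/(2r)), every β with ⟨β,v⟩ = 0 satisfies ⟨h(β),w⟩ = 0, so h restricts to an isometry from the orthogonal complement of v into the orthogonal complement of w. (This is the map h(β) = β·ch(F^∨)/√(ch(F⊗F^∨)) used in the proof of Proposition 5.3, where u = ch(F) for a stable bundle F with Mukai vector v = ch(F)·√(td S) and w is the twisted Mukai vector of F.) -/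
/-- The cup-product multiplication on the rational Mukai lattice `M(Λ) = ℚ × Λ × ℚ`:
`(r,ξ,a)·(r',ξ',a') = (r·r', r·ξ' + r'·ξ, r·a' + r'·a + (ξ,ξ'))`. -/
def mukaiMul {Λ : Type*} [AddCommGroup Λ] [Module ℚ Λ]
    (B : Λ →ₗ[ℚ] Λ →ₗ[ℚ] ℚ) (x y : ℚ × Λ × ℚ) : ℚ × Λ × ℚ :=
  (x.1 * y.1, x.1 • y.2.1 + y.1 • x.2.1, x.1 * y.2.2 + y.1 * x.2.2 + B x.2.1 y.2.1)

/-- The dual `(r,ξ,a)^∨ = (r,−ξ,a)`. -/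
def mukaiDual {Λ : Type*} [AddCommGroup Λ] [Module ℚ Λ]
    (x : ℚ × Λ × ℚ) : ℚ × Λ × ℚ :=
  (x.1, -x.2.1, x.2.2)

/-- For `u = (r,ξ,c)` with `r ≠ 0` and `s := (r, 0, c − (ξ,ξ)/(2r))`:
(i) `s·s = u·u^∨`; (ii) `s` is invertible, with inverse `(1/r, 0, −(c−(ξ,ξ)/(2r))/r²)`;
(iii) the map `h(β) = β·u^∨·s^{−1}` preserves the Mukai pairing;
(iv) `h(u·(1,0,1)) = (r, 0, r + c − (ξ,ξ)/(2r))`. In particular, with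
`v := u·(1,0,1)` and `w := (r, 0, r + c − (ξ,ξ)/(2r))`, every `β` with `⟨β,v⟩ = 0`
satisfies `⟨h(β),w⟩ = 0`. -/
theorem mukai_twisting_isometry
    {Λ : Type*} [AddCommGroup Λ] [Module ℚ Λ]
    (B : Λ →ₗ[ℚ] Λ →ₗ[ℚ] ℚ) (hB : ∀ x y, B x y = B y x)
    (r c : ℚ) (ξ : Λ) (hr : r ≠ 0)
    (u s sinv v w : ℚ × Λ × ℚ) (h : ℚ × Λ × ℚ → ℚ × Λ × ℚ)
    (hu : u = (r, ξ, c))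
    (hs : s = (r, 0, c - B ξ ξ / (2 * r)))
    (hsinv : sinv = (1 / r, 0, -(c - B ξ ξ / (2 * r)) / r ^ 2))
    (hh : ∀ β, h β = mukaiMul B (mukaiMul B β (mukaiDual u)) sinv)
    (hv : v = mukaiMul B u ((1 : ℚ), (0 : Λ), (1 : ℚ)))
    (hw : w = (r, 0, r + c - B ξ ξ / (2 * r))) :
    mukaiMul B s s = mukaiMul B u (mukaiDual u)
    ∧ mukaiMul B s sinv = ((1 : ℚ), (0 : Λ), (0 : ℚ))
    ∧ mukaiMul B sinv s = ((1 : ℚ), (0 : Λ), (0 : ℚ))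
    ∧ (∀ β β' : ℚ × Λ × ℚ, mukaiPair B (h β) (h β') = mukaiPair B β β')
    ∧ h v = w
    ∧ ∀ β : ℚ × Λ × ℚ, mukaiPair B β v = 0 → mukaiPair B (h β) w = 0 := by
  have key : ∀ β : ℚ × Λ × ℚ, h β = (β.1, β.2.1 - (β.1 / r) • ξ,
      β.2.2 - B β.2.1 ξ / r + β.1 * B ξ ξ / (2 * r ^ 2)) := by
    intro β
    rw [hh, hu, hsinv]
    simp only [mukaiMul, mukaiDual, Prod.mk.injEq]
    refine ⟨by field_simp, ?_, ?_⟩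
    · rw [smul_zero, zero_add, smul_add, smul_smul, smul_smul, smul_neg,
        one_div_mul_cancel hr, one_smul, sub_eq_add_neg, add_comm, one_div_mul_eq_div]
    · simp only [map_neg, map_zero]
      field_simp
      ring
  have pres : ∀ β β' : ℚ × Λ × ℚ, mukaiPair B (h β) (h β') = mukaiPair B β β' := by
    intro β β'
    rw [key, key]
    simp only [mukaiPair, map_sub, map_smul, LinearMap.sub_apply, LinearMap.smul_apply,
      smul_eq_mul, hB ξ β'.2.1]
    field_simp
    ring
  have hvw : h v = w := by
    rw [key, hv, hw, hu]
    simp only [mukaiMul, Prod.mk.injEq]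
    refine ⟨by ring, ?_, ?_⟩
    · simp [hr]
    · simp
      field_simp
      ring
  refine ⟨?_, ?_, ?_, pres, hvw, ?_⟩
  · rw [hs, hu]
    simp only [mukaiMul, mukaiDual, Prod.mk.injEq]
    refine ⟨trivial, by simp, ?_⟩
    simp
    field_simp
    ring
  · rw [hs, hsinv]
    simp only [mukaiMul, Prod.mk.injEq]
    refine ⟨by field_simp, by simp, ?_⟩
    simp only [map_zero]
    field_simp
    ring
  · rw [hs, hsinv]
    simp only [mukaiMul, Prod.mk.injEq]
    refine ⟨by field_simp, by simp, ?_⟩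
    simp only [map_zero]
    field_simp
    ring
  · intro β hβ
    rw [← hvw, pres, hβ]
end

section
/- Let v = (r,ξ,a) ∈ M(Λ) with r ≠ 0 and set q := ⟨v,v⟩. An element w ∈ M(Λ) satisfies ⟨w,v⟩ = 0 if and only if there exist ζ ∈ Λ and t ∈ ℚ such that w = e^{ξ/r}·((0,ζ,0) + t·(2r²,0,q)). Moreover the two summands are Mukai-orthogonal: ⟨e^{ξ/r}·(0,ζ,0), e^{ξ/r}·(2r²,0,q)⟩ = 0 for every ζ ∈ Λ. (This is the decomposition v^⊥⊗ℚ = e^{ξ/r}·(H²(S,ℚ) ⊕ ℚ(2r²,0,v²)) from the proof of Corollary 5.6.) -/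
/-- The exponential `e^δ = (1, δ, (δ,δ)/2)` for `δ ∈ Λ`. -/
def mukaiExp {Λ : Type*} [AddCommGroup Λ] [Module ℚ Λ]
    (B : Λ →ₗ[ℚ] Λ →ₗ[ℚ] ℚ) (δ : Λ) : ℚ × Λ × ℚ :=
  (1, δ, B δ δ / 2)

/-- For `v = (r,ξ,a)` with `r ≠ 0` and `q := ⟨v,v⟩`: an element `w ∈ M(Λ)` satisfies
`⟨w,v⟩ = 0` iff `w = e^{ξ/r}·((0,ζ,0) + t·(2r²,0,q))` for some `ζ ∈ Λ`, `t ∈ ℚ`;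
moreover the two summands are Mukai-orthogonal. This is the decomposition
`v^⊥⊗ℚ = e^{ξ/r}·(H²(S,ℚ) ⊕ ℚ(2r²,0,v²))`. -/
theorem mukai_orthogonal_decomposition
    {Λ : Type*} [AddCommGroup Λ] [Module ℚ Λ]
    (B : Λ →ₗ[ℚ] Λ →ₗ[ℚ] ℚ) (hB : ∀ x y, B x y = B y x)
    (r a : ℚ) (ξ : Λ) (hr : r ≠ 0) (q : ℚ)
    (hq : q = mukaiPair B (r, ξ, a) (r, ξ, a)) :
    (∀ w : ℚ × Λ × ℚ,
      mukaiPair B w (r, ξ, a) = 0 ↔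
        ∃ (ζ : Λ) (t : ℚ),
          w = mukaiMul B (mukaiExp B (r⁻¹ • ξ))
                (((0 : ℚ), ζ, (0 : ℚ)) + t • ((2 * r ^ 2 : ℚ), (0 : Λ), q)))
    ∧ ∀ ζ : Λ,
        mukaiPair B (mukaiMul B (mukaiExp B (r⁻¹ • ξ)) ((0 : ℚ), ζ, (0 : ℚ)))
          (mukaiMul B (mukaiExp B (r⁻¹ • ξ)) ((2 * r ^ 2 : ℚ), (0 : Λ), q)) = 0 := by
  have h0 : mukaiPair B (r, ξ, a) (r, ξ, a) = B ξ ξ - 2 * r * a := by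
    simp only [mukaiPair]; ring
  rw [h0] at hq
  subst hq
  refine ⟨?_, ?_⟩
  · rintro ⟨x, η, y⟩
    constructor
    · intro h
      simp only [mukaiPair] at h
      have hy : y = (B η ξ - x * a) / r := by
        field_simp
        linarith
      refine ⟨η - (x * r⁻¹) • ξ, x / (2 * r ^ 2), ?_⟩
      have hx : x / (2 * r ^ 2) * (2 * r ^ 2) = x := by field_simp
      simp only [mukaiMul, mukaiExp, Prod.mk_add_mk, Prod.smul_mk, smul_eq_mul, zero_add,
        smul_zero, add_zero, one_mul, one_smul, hx, Prod.mk.injEq, true_and]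
      refine ⟨?_, ?_⟩
      · rw [smul_smul]; abel
      · simp only [map_sub, map_smul, LinearMap.smul_apply, smul_eq_mul]
        rw [hy, hB ξ η]
        field_simp
        ring
    · rintro ⟨ζ, t, h⟩
      simp only [mukaiMul, mukaiExp, Prod.mk_add_mk, Prod.smul_mk, smul_eq_mul, zero_add,
        smul_zero, add_zero, one_mul, one_smul, Prod.mk.injEq] at h
      obtain ⟨rfl, rfl, rfl⟩ := h
      simp only [mukaiPair, map_add, map_smul, LinearMap.add_apply, LinearMap.smul_apply,
        smul_eq_mul]
      rw [hB ξ ζ]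
      field_simp
      ring
  · intro ζ
    simp only [mukaiPair, mukaiMul, mukaiExp, map_add, map_smul, LinearMap.add_apply,
      LinearMap.smul_apply, smul_eq_mul, zero_add, smul_zero, add_zero, one_mul, one_smul,
      zero_smul, zero_mul, map_zero]
    rw [hB ξ ζ]
    field_simp
    ring
end

section
/- Let v = (r,ξ,a) ∈ M(Λ) with r ≠ 0 and q := ⟨v,v⟩ ≥ 0. Then for every ζ ∈ Λ with (ζ,ζ) ≤ 0 and every t ∈ ℚ, the element w := e^{ξ/r}·((0,ζ,0) + t·(2r²,0,q)) satisfies ⟨w,w⟩ = (ζ,ζ) − 4r²·q·t² ≤ 0. (This is the key step in the proof of Theorem 1.2/Corollary 5.6: if S is non-projective, so that the intersection form is negative semi-definite on NS(S)⊗ℚ, and v² ≥ 0, then the (1,1)-part of v^⊥⊗ℚ is negative semi-definite, and hence the moduli space M^μ_v(S,ω) cannot be projective.) -/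
/-- Key step in the proof of Theorem 1.2/Corollary 5.6: for `v = (r,ξ,a)` with `r ≠ 0`
and `q := ⟨v,v⟩ ≥ 0`, for every `ζ ∈ Λ` with `(ζ,ζ) ≤ 0` and every `t ∈ ℚ`, the element
`w := e^{ξ/r}·((0,ζ,0) + t·(2r²,0,q))` satisfies `⟨w,w⟩ = (ζ,ζ) − 4r²·q·t² ≤ 0`. -/
theorem mukai_orthogonal_negative_semidefinite
    {Λ : Type*} [AddCommGroup Λ] [Module ℚ Λ]
    (B : Λ →ₗ[ℚ] Λ →ₗ[ℚ] ℚ) (hB : ∀ x y, B x y = B y x)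
    (r a : ℚ) (ξ : Λ) (hr : r ≠ 0) (q : ℚ)
    (hq : q = mukaiPair B (r, ξ, a) (r, ξ, a)) (hq0 : 0 ≤ q)
    (ζ : Λ) (hζ : B ζ ζ ≤ 0) (t : ℚ)
    (w : ℚ × Λ × ℚ)
    (hw : w = mukaiMul B (mukaiExp B (r⁻¹ • ξ))
        (((0 : ℚ), ζ, (0 : ℚ)) + t • ((2 * r ^ 2 : ℚ), (0 : Λ), q))) :
    mukaiPair B w w = B ζ ζ - 4 * r ^ 2 * q * t ^ 2 ∧ mukaiPair B w w ≤ 0 := by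
  have key : mukaiPair B w w = B ζ ζ - 4 * r ^ 2 * q * t ^ 2 := by
    clear hq
    subst hw
    generalize r⁻¹ • ξ = δ
    simp only [mukaiPair, mukaiMul, mukaiExp, Prod.fst_add, Prod.snd_add, Prod.smul_fst,
      Prod.smul_snd, smul_eq_mul, smul_zero, add_zero, zero_add, one_smul, map_add, map_smul,
      LinearMap.add_apply, LinearMap.smul_apply]
    rw [hB ζ δ]
    ring
  refine ⟨key, ?_⟩
  rw [key]
  have h : 0 ≤ 4 * r ^ 2 * q * t ^ 2 := by positivity
  linarith
end

section
/- Let ξ ∈ Λ with (ξ,ξ) < 0. Let r₁, r₂ be positive integers with r := r₁ + r₂, let n₁, n₂ ∈ ℤ with n₁ + n₂ = 1, let a₁, a₂ ∈ ℚ, and set v₁ := (r₁, n₁·ξ, a₁), v₂ := (r₂, n₂·ξ, a₂) and v := v₁ + v₂ in M(Λ). If Δ(v₁) ≥ 0 and Δ(v₂) ≥ 0, then Δ(v) ≥ −(ξ,ξ)/(2r²(r−1)). (This is the estimate in the proof of Proposition 4.16: on a non-algebraic K3 surface with NS(X) = ℤξ and ξ² = 2g−2 < 0, any destabilizing exact sequence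 0 → E₁ → E → E₂ → 0 forces Δ(E) ≥ −ξ²/(2r²(r−1)) = (1−g)/((r−1)r²); for g ≤ −(r²−1)(r−1) this contradicts the assumed invariants, so E is irreducible.) -/
theorem mukai_key_int (r s n : ℤ) (h₁ : 0 < r) (h₂ : 0 < s) :
    r * s ≤ (n * (r + s) - r) ^ 2 * (r + s - 1) := by
  have hp : 0 ≤ r + s - 1 := by linarith
  rcases le_or_gt n 0 with h | h
  · have hk : r ^ 2 ≤ (n * (r + s) - r) ^ 2 := by
      have : n * (r + s) ≤ 0 := mul_nonpos_of_nonpos_of_nonneg h (by linarith)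
      nlinarith
    have h3 : s ≤ r * (r + s - 1) := by nlinarith
    nlinarith [mul_le_mul_of_nonneg_right hk hp, mul_le_mul_of_nonneg_left h3 h₁.le]
  · have hk : s ^ 2 ≤ (n * (r + s) - r) ^ 2 := by
      have : s ≤ n * (r + s) - r := by nlinarith
      nlinarith
    have h3 : r ≤ s * (r + s - 1) := by nlinarith
    nlinarith [mul_le_mul_of_nonneg_right hk hp, mul_le_mul_of_nonneg_left h3 h₂.le]

/-- The estimate from the proof of Proposition 4.16: let `(ξ,ξ) < 0`, `r₁, r₂ > 0`
integers with `r = r₁ + r₂`, `n₁ + n₂ = 1` integers, and set `v₁ = (r₁, n₁·ξ, a₁)`,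
`v₂ = (r₂, n₂·ξ, a₂)`, `v = v₁ + v₂`. If `Δ(v₁) ≥ 0` and `Δ(v₂) ≥ 0`, then
`Δ(v) ≥ −(ξ,ξ)/(2r²(r−1))`. -/
theorem mukai_irreducibility_estimate
    {Λ : Type*} [AddCommGroup Λ] [Module ℚ Λ]
    (B : Λ →ₗ[ℚ] Λ →ₗ[ℚ] ℚ) (hB : ∀ x y, B x y = B y x)
    (ξ : Λ) (hξ : B ξ ξ < 0)
    (r₁ r₂ : ℤ) (h₁ : 0 < r₁) (h₂ : 0 < r₂)
    (n₁ n₂ : ℤ) (hn : n₁ + n₂ = 1) (a₁ a₂ : ℚ)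
    (v₁ v₂ v : ℚ × Λ × ℚ)
    (hv₁ : v₁ = ((r₁ : ℚ), (n₁ : ℚ) • ξ, a₁))
    (hv₂ : v₂ = ((r₂ : ℚ), (n₂ : ℚ) • ξ, a₂))
    (hv : v = v₁ + v₂)
    (hΔ₁ : 0 ≤ mukaiDisc B v₁) (hΔ₂ : 0 ≤ mukaiDisc B v₂) :
    -B ξ ξ / (2 * ((r₁ : ℚ) + (r₂ : ℚ)) ^ 2 * (((r₁ : ℚ) + (r₂ : ℚ)) - 1))
      ≤ mukaiDisc B v := by
  have key := mukai_key_int r₁ r₂ n₁ h₁ h₂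
  have key' : (r₁ : ℚ) * r₂ ≤ ((n₁ : ℚ) * (r₁ + r₂) - r₁) ^ 2 * (r₁ + r₂ - 1) := by
    exact_mod_cast key
  have hn' : (n₂ : ℚ) = 1 - n₁ := by
    have : (n₁ : ℚ) + n₂ = 1 := by exact_mod_cast hn
    linarith
  have p1 : (0 : ℚ) < r₁ := by exact_mod_cast h₁
  have p2 : (0 : ℚ) < r₂ := by exact_mod_cast h₂
  have p3 : (0 : ℚ) < (r₁ : ℚ) + r₂ - 1 := by
    have : (1 : ℚ) ≤ r₁ := by exact_mod_cast h₁
    linarith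
  have e : mukaiDisc B v = -B ξ ξ * ((n₁ : ℚ) * (r₁ + r₂) - r₁) ^ 2
        / (2 * ((r₁ : ℚ) + r₂) ^ 2 * (r₁ * r₂))
      + (r₁ / (r₁ + r₂)) * mukaiDisc B v₁ + (r₂ / (r₁ + r₂)) * mukaiDisc B v₂ := by
    subst hv hv₁ hv₂
    have p4 : (r₁ : ℚ) + r₂ ≠ 0 := by positivity
    simp only [mukaiDisc, mukaiPair, Prod.mk_add_mk, map_add, map_smul, LinearMap.add_apply,
      LinearMap.smul_apply, smul_eq_mul, hn']
    field_simp
    ring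
  have m : -B ξ ξ / (2 * ((r₁ : ℚ) + r₂) ^ 2 * ((r₁ + r₂) - 1)) ≤
      -B ξ ξ * ((n₁ : ℚ) * (r₁ + r₂) - r₁) ^ 2 / (2 * ((r₁ : ℚ) + r₂) ^ 2 * (r₁ * r₂)) := by
    rw [div_le_div_iff₀ (by positivity) (by positivity)]
    have hc : 0 ≤ -B ξ ξ * (2 * ((r₁ : ℚ) + r₂) ^ 2) :=
      mul_nonneg (by linarith) (by positivity)
    have := mul_le_mul_of_nonneg_left key' hc
    linarith
  have t1 : 0 ≤ ((r₁ : ℚ) / (r₁ + r₂)) * mukaiDisc B v₁ := mul_nonneg (by positivity) hΔ₁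
  have t2 : 0 ≤ ((r₂ : ℚ) / (r₁ + r₂)) * mukaiDisc B v₂ := mul_nonneg (by positivity) hΔ₂
  rw [e]
  linarith
end
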